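/- arXiv:math/0505514 — 6 statements merged into one kernel-verified Lean document; each statement's English description precedes it below -/
import Mathlib

section
/- If y : [0,1] → ℝ is twice continuously differentiable, satisfies y''(x) = 2·y(x)³ for all x ∈ [0,1], and satisfies y(0) = 1/2 and y(1) = 1/3, then y(x) = 1/(x+2) for all x ∈ [0,1]; that is, the boundary value problem has a unique solution. -/
/-- A function vanishing at both endpoints of `[a, b]` and satisfying `0 ≤ w * w''` there is
identically zero on `[a, b]`. -/
theorem eq_zero_of_mul_secondDeriv_nonneg {a b : ℝ} {w w' w'' : ℝ → ℝ}
    (hw : ∀ x ∈ Set.Icc a b, HasDerivWithinAt w (w' x) (Set.Icc a b) x)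
    (hw' : ∀ x ∈ Set.Icc a b, HasDerivWithinAt w' (w'' x) (Set.Icc a b) x)
    (hnonneg : ∀ x ∈ Set.Icc a b, 0 ≤ w x * w'' x) (ha : w a = 0) (hb : w b = 0) :
    ∀ x ∈ Set.Icc a b, w x = 0 := by
  intro x hx
  have hab : a ≤ b := hx.1.trans hx.2
  have hprod : ∀ t ∈ Set.Icc a b, HasDerivWithinAt (fun t => w t * w' t)
      (w' t * w' t + w t * w'' t) (Set.Icc a b) t :=
    fun t ht => (hw t ht).mul (hw' t ht)
  have hprod_mono : MonotoneOn (fun t => w t * w' t) (Set.Icc a b) :=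
    monotoneOn_of_hasDerivWithinAt_nonneg (convex_Icc a b)
      (fun t ht => (hprod t ht).continuousWithinAt)
      (fun t ht => (hprod t (interior_subset ht)).mono interior_subset)
      (fun t ht => add_nonneg (mul_self_nonneg _) (hnonneg t (interior_subset ht)))
  have hprod_nonneg : ∀ t ∈ Set.Icc a b, 0 ≤ w t * w' t := fun t ht => by
    simpa [ha] using hprod_mono (Set.left_mem_Icc.2 hab) ht ht.1
  have hsq : ∀ t ∈ Set.Icc a b, HasDerivWithinAt (fun t => w t * w t)
      (w' t * w t + w t * w' t) (Set.Icc a b) t :=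
    fun t ht => (hw t ht).mul (hw t ht)
  have hsq_mono : MonotoneOn (fun t => w t * w t) (Set.Icc a b) :=
    monotoneOn_of_hasDerivWithinAt_nonneg (convex_Icc a b)
      (fun t ht => (hsq t ht).continuousWithinAt)
      (fun t ht => (hsq t (interior_subset ht)).mono interior_subset)
      (fun t ht => by linarith [hprod_nonneg t (interior_subset ht)])
  have hle : w x * w x ≤ 0 := by
    simpa [hb] using hsq_mono hx (Set.right_mem_Icc.2 hab) hx.2
  exact mul_self_eq_zero.1 (hle.antisymm (mul_self_nonneg _))

/-- Uniqueness: any twice continuously differentiable solution on `[0,1]` of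
`y'' = 2 y^3` with `y 0 = 1/2`, `y 1 = 1/3` equals `x ↦ 1/(x+2)` on `[0,1]`. -/
theorem bvp_example_unique (y : ℝ → ℝ)
    (hy : ContDiffOn ℝ 2 y (Set.Icc 0 1))
    (hode : ∀ x ∈ Set.Icc (0:ℝ) 1,
      iteratedDerivWithin 2 y (Set.Icc 0 1) x = 2 * (y x)^3)
    (h0 : y 0 = 1 / 2) (h1 : y 1 = 1 / 3) :
    ∀ x ∈ Set.Icc (0:ℝ) 1, y x = 1 / (x + 2) := by
  have hunique : UniqueDiffOn ℝ (Set.Icc (0:ℝ) 1) := uniqueDiffOn_Icc zero_lt_one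
  have hy1 : ∀ x ∈ Set.Icc (0:ℝ) 1,
      HasDerivWithinAt y (derivWithin y (Set.Icc 0 1) x) (Set.Icc 0 1) x :=
    fun x hx => (hy.differentiableOn (by norm_num) x hx).hasDerivWithinAt
  have hy2 : ∀ x ∈ Set.Icc (0:ℝ) 1,
      HasDerivWithinAt (derivWithin y (Set.Icc 0 1)) (2 * (y x)^3) (Set.Icc 0 1) x := by
    intro x hx
    have hdiff := (hy.differentiableOn_iteratedDerivWithin (m := 1) (by norm_num) hunique x
      hx).hasDerivWithinAt
    rwa [← iteratedDerivWithin_succ, hode x hx, iteratedDerivWithin_one] at hdiff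
  have hz1 : ∀ x ∈ Set.Icc (0:ℝ) 1,
      HasDerivWithinAt (fun t : ℝ => 1 / (t + 2)) (-1 / (x + 2) ^ 2) (Set.Icc 0 1) x := by
    intro x hx
    have hne : x + 2 ≠ 0 := by linarith [hx.1]
    simp only [one_div]
    exact (((hasDerivAt_id x).add_const 2).inv hne).hasDerivWithinAt
  have hz2 : ∀ x ∈ Set.Icc (0:ℝ) 1,
      HasDerivWithinAt (fun t : ℝ => -1 / (t + 2) ^ 2) (2 * (1 / (x + 2)) ^ 3)
        (Set.Icc 0 1) x := by
    intro x hx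
    have hne : x + 2 ≠ 0 := by linarith [hx.1]
    have hderiv := ((hasDerivAt_const x (-1 : ℝ)).div
      (((hasDerivAt_id x).add_const 2).pow 2) (pow_ne_zero 2 hne)).hasDerivWithinAt
      (s := Set.Icc 0 1)
    refine hderiv.congr_deriv ?_
    simp
    field_simp
  have hmono : ∀ u v : ℝ, 0 ≤ (u - v) * (2 * u ^ 3 - 2 * v ^ 3) := fun u v => by
    have hfactor : (u - v) * (2 * u ^ 3 - 2 * v ^ 3) =
        (u - v) ^ 2 * (u ^ 2 + v ^ 2 + (u + v) ^ 2) := by ring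
    rw [hfactor]
    positivity
  intro x hx
  exact sub_eq_zero.1 <| eq_zero_of_mul_secondDeriv_nonneg
    (w := fun t => y t - 1 / (t + 2))
    (fun t ht => (hy1 t ht).sub (hz1 t ht)) (fun t ht => (hy2 t ht).sub (hz2 t ht))
    (fun t _ => hmono (y t) (1 / (t + 2))) (by norm_num [h0]) (by norm_num [h1]) x hx
end

section
/- For every integer N ≥ 1, with h = 1/(N+1), the system of N equations in the unknowns (y_1,...,y_N) ∈ ℝ^N given by y_{i-1} − 2y_i + y_{i+1} = 2h²·y_i³ for i = 1,...,N, where y_0 = 1/2 and y_{N+1} = 1/3, has exactly one real solution. -/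
/-- Extension of a vector of interior mesh values by the boundary values `α` at
index `0` and `β` at indices beyond `N`. -/
def meshExtend {N : ℕ} (α β : ℝ) (y : Fin N → ℝ) : ℕ → ℝ :=
  fun i => if h : 1 ≤ i ∧ i ≤ N then y ⟨i - 1, by omega⟩ else if i = 0 then α else β

/-- The sequence with initial values `a`, `t` whose second difference is prescribed by
`u (n + 2) - 2 * u (n + 1) + u n = g (u (n + 1))`. -/
def shoot (g : ℝ → ℝ) (a t : ℝ) : ℕ → ℝ
  | 0 => a
  | 1 => t
  | n + 2 => 2 * shoot g a t (n + 1) - shoot g a t n + g (shoot g a t (n + 1))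

theorem shoot_sub_bounds {g : ℝ → ℝ} (hg : Monotone g) (a : ℝ) {s t : ℝ} (hst : s ≤ t) (n : ℕ) :
    0 ≤ shoot g a t n - shoot g a s n ∧
      t - s ≤ (shoot g a t (n + 1) - shoot g a s (n + 1)) - (shoot g a t n - shoot g a s n) := by
  induction n with
  | zero => simp [shoot]
  | succ n ih =>
    obtain ⟨h₁, h₂⟩ := ih
    have h₃ : shoot g a s (n + 1) ≤ shoot g a t (n + 1) := by linarith
    have h₄ := hg h₃
    refine ⟨by linarith, ?_⟩
    simp only [shoot]
    linarith

theorem sub_le_shoot_sub {g : ℝ → ℝ} (hg : Monotone g) (a : ℝ) {s t : ℝ} (hst : s ≤ t) (n : ℕ) :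
    t - s ≤ shoot g a t (n + 1) - shoot g a s (n + 1) := by
  obtain ⟨h₁, h₂⟩ := shoot_sub_bounds hg a hst n
  linarith

theorem shoot_strictMono {g : ℝ → ℝ} (hg : Monotone g) (a : ℝ) (n : ℕ) :
    StrictMono fun t => shoot g a t (n + 1) := by
  intro s t hst
  have := sub_le_shoot_sub hg a hst.le n
  show shoot g a s (n + 1) < shoot g a t (n + 1)
  linarith

theorem continuous_shoot {g : ℝ → ℝ} (hg : Continuous g) (a : ℝ) (n : ℕ) :
    Continuous fun t => shoot g a t n := by
  induction n using Nat.twoStepInduction with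
  | zero => simpa only [shoot] using continuous_const
  | one => simpa only [shoot] using continuous_id'
  | more n ih₀ ih₁ => simpa only [shoot] using by fun_prop

theorem shoot_surjective {g : ℝ → ℝ} (hg : Monotone g) (hc : Continuous g) (a : ℝ) (n : ℕ) :
    Function.Surjective fun t => shoot g a t (n + 1) := by
  intro b
  set d := b - shoot g a 0 (n + 1) with hd
  refine mem_range_of_exists_le_of_exists_ge (continuous_shoot hc a (n + 1))
    ⟨min 0 d, ?_⟩ ⟨max 0 d, ?_⟩
  · have := sub_le_shoot_sub hg a (min_le_left 0 d) n
    linarith [min_le_right 0 d]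
  · have := sub_le_shoot_sub hg a (le_max_left 0 d) n
    linarith [le_max_right 0 d]

theorem meshExtend_zero {N : ℕ} (α β : ℝ) (y : Fin N → ℝ) : meshExtend α β y 0 = α := by
  simp [meshExtend]

theorem meshExtend_last {N : ℕ} (α β : ℝ) (y : Fin N → ℝ) : meshExtend α β y (N + 1) = β := by
  simp [meshExtend]

theorem meshExtend_fin_succ {N : ℕ} (α β : ℝ) (y : Fin N → ℝ) (i : Fin N) :
    meshExtend α β y (i + 1) = y i := by
  simp [meshExtend, Nat.succ_le_of_lt i.isLt]

theorem meshExtend_shoot {N : ℕ} {g : ℝ → ℝ} {α β t : ℝ} (ht : shoot g α t (N + 1) = β) {j : ℕ}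
    (hj : j ≤ N + 1) :
    meshExtend α β (fun i : Fin N => shoot g α t (i + 1)) j = shoot g α t j := by
  rcases Nat.eq_zero_or_pos j with rfl | h0
  · rw [meshExtend_zero, shoot]
  rcases hj.eq_or_lt with rfl | h1
  · rw [meshExtend_last, ht]
  · obtain ⟨k, rfl⟩ := Nat.exists_eq_add_of_le' h0
    exact meshExtend_fin_succ α β _ ⟨k, by omega⟩

theorem meshExtend_eq_shoot {N : ℕ} {g : ℝ → ℝ} {α β : ℝ} {y : Fin N → ℝ}
    (hy : ∀ i : ℕ, 1 ≤ i → i ≤ N →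
      meshExtend α β y (i - 1) - 2 * meshExtend α β y i + meshExtend α β y (i + 1)
        = g (meshExtend α β y i)) (j : ℕ) (hj : j ≤ N + 1) :
    meshExtend α β y j = shoot g α (meshExtend α β y 1) j := by
  induction j using Nat.twoStepInduction with
  | zero => rw [meshExtend_zero, shoot]
  | one => rw [shoot]
  | more n ih₀ ih₁ =>
    have h := hy (n + 1) (by omega) (by omega)
    rw [Nat.add_sub_cancel] at h
    rw [shoot, ← ih₀ (by omega), ← ih₁ (by omega)]
    linarith

theorem existsUnique_mesh_solution (N : ℕ) {g : ℝ → ℝ} (hg : Monotone g) (hc : Continuous g)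
    (α β : ℝ) :
    ∃! y : Fin N → ℝ, ∀ i : ℕ, 1 ≤ i → i ≤ N →
      meshExtend α β y (i - 1) - 2 * meshExtend α β y i + meshExtend α β y (i + 1)
        = g (meshExtend α β y i) := by
  obtain ⟨t, ht⟩ := shoot_surjective hg hc α N β
  refine ⟨fun i => shoot g α t (i + 1), fun i h1 hN => ?_, fun y hy => ?_⟩
  · rw [meshExtend_shoot ht (by omega), meshExtend_shoot ht (by omega),
      meshExtend_shoot ht (by omega)]
    obtain ⟨k, rfl⟩ := Nat.exists_eq_add_of_le' h1
    rw [Nat.add_sub_cancel, shoot]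
    ring
  · have h := meshExtend_eq_shoot hy
    have hs : meshExtend α β y 1 = t := by
      refine (shoot_strictMono hg α N).injective ?_
      exact (h (N + 1) le_rfl).symm.trans ((meshExtend_last α β y).trans ht.symm)
    funext i
    rw [← meshExtend_fin_succ α β y i, h _ (by omega), hs]

/-- For every `N ≥ 1`, the central-difference discretization of `y'' = 2 y^3` on `[0,1]`
with `y 0 = 1/2`, `y 1 = 1/3`, mesh size `h = 1/(N+1)`, has exactly one real solution. -/
theorem discretization_unique_solution (N : ℕ) (hN : 1 ≤ N) :
    ∃! y : Fin N → ℝ,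
      ∀ i : ℕ, 1 ≤ i → i ≤ N →
        meshExtend (1/2) (1/3) y (i - 1) - 2 * meshExtend (1/2) (1/3) y i
            + meshExtend (1/2) (1/3) y (i + 1)
          = (1 / ((N : ℝ) + 1))^2 * (2 * (meshExtend (1/2) (1/3) y i)^3) := by
  refine existsUnique_mesh_solution N (g := fun x => (1 / ((N : ℝ) + 1)) ^ 2 * (2 * x ^ 3))
    (fun x z hxz => ?_) (by fun_prop) (1/2) (1/3)
  have : x ^ 3 ≤ z ^ 3 := (Odd.strictMono_pow (by decide)).monotone hxz
  dsimp only
  gcongr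
end

section
/- For every real λ > 0, the set of twice continuously differentiable functions y : [0,1] → ℝ satisfying y''(x) = −λ·y(x)³ for all x ∈ [0,1] and y(0) = y(1) = 0 is infinite. -/
/-- For a continuous, positive and bounded `v`, the autonomous equation `θ' = v θ` has a solution
`θ` with `θ 0 = 0` that is an order isomorphism of `ℝ`; here `T` is its inverse. -/
theorem exists_global_solution {v : ℝ → ℝ} (hv : Continuous v) (hpos : ∀ s, 0 < v s)
    {C : ℝ} (hC : ∀ s, v s ≤ C) :
    ∃ T : ℝ ≃o ℝ, T 0 = 0 ∧ ∀ t, HasDerivAt T.symm (v (T.symm t)) t := by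
  have hC0 : 0 < C := (hpos 0).trans_le (hC 0)
  have hinv : Continuous fun s => (v s)⁻¹ := hv.inv₀ fun s => (hpos s).ne'
  set F : ℝ → ℝ := fun x => ∫ s in (0 : ℝ)..x, (v s)⁻¹ with hF
  have hF0 : F 0 = 0 := by simp [hF]
  have hderiv (x : ℝ) : HasDerivAt F (v x)⁻¹ x :=
    intervalIntegral.integral_hasDerivAt_right (hinv.intervalIntegrable _ _)
      (hinv.stronglyMeasurableAtFilter _ _) hinv.continuousAt
  have hcont : Continuous F := continuous_iff_continuousAt.2 fun x => (hderiv x).continuousAt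
  have hmono : StrictMono F := strictMono_of_deriv_pos fun x => by
    rw [(hderiv x).deriv]; exact inv_pos.2 (hpos x)
  have hlin : Monotone fun x => F x - C⁻¹ * x := by
    have hd (x : ℝ) : HasDerivAt (fun x => F x - C⁻¹ * x) ((v x)⁻¹ - C⁻¹ * 1) x :=
      (hderiv x).sub ((hasDerivAt_id x).const_mul C⁻¹)
    refine monotone_of_deriv_nonneg (fun x => (hd x).differentiableAt) fun x => ?_
    rw [(hd x).deriv, mul_one, sub_nonneg]
    exact inv_anti₀ (hpos x) (hC x)
  have hsurj : Function.Surjective F := by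
    refine hcont.surjective ?_ ?_
    · refine Filter.tendsto_atTop_mono' _ ?_
        (Filter.tendsto_id.const_mul_atTop (inv_pos.2 hC0))
      filter_upwards [Filter.eventually_ge_atTop 0] with x hx
      have := hlin hx
      simp only [hF0, mul_zero, sub_zero] at this
      simpa using this
    · refine Filter.tendsto_atBot_mono' _ ?_
        (Filter.tendsto_id.const_mul_atBot (inv_pos.2 hC0))
      filter_upwards [Filter.eventually_le_atBot 0] with x hx
      have := hlin hx
      simp only [hF0, mul_zero, sub_zero] at this
      simpa using this
  refine ⟨hmono.orderIsoOfSurjective F hsurj, hF0, fun t => ?_⟩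
  set T := hmono.orderIsoOfSurjective F hsurj
  have h := HasDerivAt.of_local_left_inverse (f := F) (g := T.symm) (a := t)
    T.symm.continuous.continuousAt (hderiv _) (inv_pos.2 (hpos _)).ne'
    (Filter.Eventually.of_forall fun y => T.apply_symm_apply y)
  simpa using h

theorem contDiff_two_of_hasDerivAt {y u v : ℝ → ℝ} (h : ∀ x, HasDerivAt y (u x) x)
    (h' : ∀ x, HasDerivAt u (v x) x) (hc : Continuous v) : ContDiff ℝ 2 y := by
  have e : deriv y = u := funext fun x => (h x).deriv
  have e' : deriv u = v := funext fun x => (h' x).deriv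
  rw [show (2 : WithTop ℕ∞) = 1 + 1 by norm_num, contDiff_succ_iff_deriv]
  refine ⟨fun x => (h x).differentiableAt, by simp, ?_⟩
  rw [e, contDiff_one_iff_deriv, e']
  exact ⟨fun x => (h' x).differentiableAt, hc⟩

/-- If `θ' = √(1 + sin² θ)` then `w = sin θ` (the lemniscate sine) solves `w'' = -2 w³`. -/
theorem hasDerivAt_sin_comp {θ : ℝ → ℝ}
    (hθ : ∀ t, HasDerivAt θ (√(1 + Real.sin (θ t) ^ 2)) t) (t : ℝ) :
    HasDerivAt (fun t => Real.sin (θ t)) (Real.cos (θ t) * √(1 + Real.sin (θ t) ^ 2)) t ∧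
    HasDerivAt (fun t => Real.cos (θ t) * √(1 + Real.sin (θ t) ^ 2))
      (-2 * Real.sin (θ t) ^ 3) t := by
  have hp : 0 < 1 + Real.sin (θ t) ^ 2 := by positivity
  have hs := (hθ t).sin
  refine ⟨hs, ?_⟩
  have hr := ((hs.pow 2).const_add 1).sqrt hp.ne'
  refine ((hθ t).cos.mul hr).congr_deriv ?_
  have hne := (Real.sqrt_pos.2 hp).ne'
  have hsq := Real.sq_sqrt hp.le
  have hcos := Real.cos_sq' (θ t)
  simp only [Pi.pow_apply]
  field_simp
  rw [hsq, hcos]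
  push_cast
  ring

/-- For every `λ > 0`, the BVP `y'' = -λ y^3` on `[0,1]` with zero boundary
conditions has infinitely many twice continuously differentiable solutions
(counted as functions on `[0,1]`). -/
theorem infinitely_many_solutions (lam : ℝ) (hlam : 0 < lam) :
    { f : Set.Icc (0:ℝ) 1 → ℝ | ∃ y : ℝ → ℝ,
        ContDiffOn ℝ 2 y (Set.Icc 0 1) ∧
        (∀ x ∈ Set.Icc (0:ℝ) 1,
          iteratedDerivWithin 2 y (Set.Icc 0 1) x = -lam * (y x)^3) ∧
        y 0 = 0 ∧ y 1 = 0 ∧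
        f = (Set.Icc (0:ℝ) 1).restrict y }.Infinite := by
  obtain ⟨T, hT0, hT⟩ := exists_global_solution (v := fun s => √(1 + Real.sin s ^ 2))
    (by fun_prop) (fun s => by positivity) (C := √2)
    (fun s => Real.sqrt_le_sqrt (by linarith [Real.sin_sq_le_one s]))
  have hS0 : T.symm 0 = 0 := by rw [← hT0, T.symm_apply_apply, hT0]
  set L : ℕ → ℝ := fun k => T (k * Real.pi) with hL
  have hL0 (k : ℕ) : 0 ≤ L k := by
    rw [← hT0]; exact T.monotone (by positivity)
  set a : ℝ := √(2 / lam) with ha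
  have ha0 : 0 < a := by positivity
  have ha2 : lam * a ^ 2 = 2 := by
    rw [ha, Real.sq_sqrt (by positivity)]; field_simp
  set y : ℕ → ℝ → ℝ := fun k x => a * L k * Real.sin (T.symm (L k * x)) with hy
  have hmul (k : ℕ) (x : ℝ) : HasDerivAt (fun x => L k * x) (L k) x := by
    simpa using (hasDerivAt_id x).const_mul (L k)
  have hd (k : ℕ) (x : ℝ) : HasDerivAt (y k) (a * L k * (Real.cos (T.symm (L k * x)) *
      √(1 + Real.sin (T.symm (L k * x)) ^ 2) * L k)) x :=
    (((hasDerivAt_sin_comp hT (L k * x)).1).comp x (hmul k x)).const_mul _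
  have hd' (k : ℕ) (x : ℝ) : HasDerivAt (fun x => a * L k * (Real.cos (T.symm (L k * x)) *
      √(1 + Real.sin (T.symm (L k * x)) ^ 2) * L k)) (-lam * y k x ^ 3) x := by
    refine (((((hasDerivAt_sin_comp hT (L k * x)).2).comp x (hmul k x)).mul_const
      (L k)).const_mul (a * L k)).congr_deriv ?_
    simp only [hy]
    linear_combination a * L k ^ 3 * Real.sin (T.symm (L k * x)) ^ 3 * ha2
  have hC2 (k : ℕ) : ContDiff ℝ 2 (y k) :=
    contDiff_two_of_hasDerivAt (hd k) (hd' k) <| by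
      have : Continuous (y k) := continuous_iff_continuousAt.2 fun x => (hd k x).continuousAt
      fun_prop
  refine Set.infinite_of_injective_forall_mem
    (f := fun k : ℕ => (Set.Icc (0 : ℝ) 1).domRestrict (y k)) ?_ fun k =>
    ⟨y k, (hC2 k).contDiffOn, fun x hx => ?_, by simp [hy, hS0], by simp [hy, hL], rfl⟩
  · intro j k hjk
    have heq : Set.EqOn (y j) (y k) (Set.Icc 0 1) := Set.domRestrict_eq_domRestrict_iff.1 hjk
    have h0 : (0 : ℝ) ∈ Set.Icc (0 : ℝ) 1 := by simp
    have hu : UniqueDiffWithinAt ℝ (Set.Icc (0 : ℝ) 1) 0 := uniqueDiffOn_Icc_zero_one 0 h0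
    have h := hu.eq_deriv _ (hd j 0).hasDerivWithinAt
      ((hd k 0).hasDerivWithinAt.congr heq (heq h0))
    simp only [mul_zero, hS0, Real.cos_zero, Real.sin_zero, ne_eq, OfNat.ofNat_ne_zero,
      not_false_eq_true, zero_pow, add_zero, Real.sqrt_one, one_mul, mul_assoc] at h
    have hLL : L j = L k :=
      (mul_self_inj (hL0 j) (hL0 k)).1 (mul_left_cancel₀ ha0.ne' h)
    exact_mod_cast mul_right_cancel₀ Real.pi_ne_zero (T.injective hLL)
  · rw [iteratedDerivWithin_eq_iteratedDeriv uniqueDiffOn_Icc_zero_one (hC2 k).contDiffAt hx,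
      iteratedDeriv_succ, iteratedDeriv_one, funext fun x => (hd k x).deriv, (hd' k x).deriv]
end

section
/- Let h > 0, let x ∈ ℝ, and let y : ℝ → ℝ be five times continuously differentiable on [x−2h, x+2h], with |y⁽⁵⁾(s)| ≤ M for all s ∈ [x−2h, x+2h]. Then |(y(x+2h) − 2y(x+h) + 2y(x−h) − y(x−2h))/(2h³) − y'''(x)| ≤ (17/60)·h²·M. -/
theorem iteratedDerivWithin_of_subset {𝕜 F : Type*} [NontriviallyNormedField 𝕜]
    [NormedAddCommGroup F] [NormedSpace 𝕜 F] {f : 𝕜 → F} {s t : Set 𝕜} {n : ℕ} {x : 𝕜}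
    (st : s ⊆ t) (hs : UniqueDiffOn 𝕜 s) (ht : UniqueDiffOn 𝕜 t) (hf : ContDiffOn 𝕜 n f t)
    (hx : x ∈ s) : iteratedDerivWithin n f s x = iteratedDerivWithin n f t x := by
  simp only [iteratedDerivWithin, iteratedFDerivWithin_subset st hs ht hf hx]

/-- Taylor's theorem with a uniform bound on the remainder, with derivatives taken within a set
containing the segment from `x₀` to `x`. -/
theorem abs_sub_taylorWithinEval_le {f : ℝ → ℝ} {s : Set ℝ} {x₀ x M : ℝ} {n : ℕ}
    (hs : UniqueDiffOn ℝ s) (hf : ContDiffOn ℝ (n + 1 : ℕ) f s) (hx : x₀ ≠ x)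
    (hsub : Set.uIcc x₀ x ⊆ s) (hM : ∀ t ∈ s, |iteratedDerivWithin (n + 1) f s t| ≤ M) :
    |f x - taylorWithinEval f n s x₀ x| ≤ M * |x - x₀| ^ (n + 1) / (n + 1).factorial := by
  have hu : UniqueDiffOn ℝ (Set.uIcc x₀ x) := uniqueDiffOn_uIcc hx
  have hf' : ContDiffOn ℝ (n + 1 : ℕ) f (Set.uIcc x₀ x) := hf.mono hsub
  have hd : DifferentiableOn ℝ (iteratedDerivWithin n f (Set.uIcc x₀ x)) (Set.uIoo x₀ x) :=
    (hf'.differentiableOn_iteratedDerivWithin (mod_cast n.lt_succ_self) hu).mono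
      Set.Ioo_subset_Icc_self
  have hle : ((n : ℕ) : WithTop ℕ∞) ≤ (n + 1 : ℕ) := mod_cast n.le_succ
  obtain ⟨t, ht, h⟩ := taylor_mean_remainder_lagrange hx (hf'.of_le hle) hd
  have ht' : t ∈ Set.uIcc x₀ x := Set.Ioo_subset_Icc_self ht
  have heval : taylorWithinEval f n (Set.uIcc x₀ x) x₀ x = taylorWithinEval f n s x₀ x := by
    simp only [taylor_within_apply]
    refine Finset.sum_congr rfl fun k hk => ?_
    have hk' : (k : WithTop ℕ∞) ≤ (n + 1 : ℕ) :=
      mod_cast (Finset.mem_range.mp hk).le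
    rw [iteratedDerivWithin_of_subset hsub hu hs (hf.of_le hk') Set.left_mem_uIcc]
  rw [← heval, h, iteratedDerivWithin_of_subset hsub hu hs hf ht', abs_div, abs_mul, abs_pow,
    Nat.abs_cast]
  gcongr
  exact hM t (hsub ht')

/-- Second-order accuracy of the central difference approximation of `y'''`:
if `y` is `C⁵` on `[x-2h, x+2h]` with `|y⁽⁵⁾| ≤ M` there, then the central
difference quotient approximates `y''' (x)` with error at most `(17/60) h² M`. -/
theorem central_difference_third_derivative (h : ℝ) (hh : 0 < h) (x : ℝ)
    (y : ℝ → ℝ) (M : ℝ)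
    (hy : ContDiffOn ℝ 5 y (Set.Icc (x - 2*h) (x + 2*h)))
    (hM : ∀ s ∈ Set.Icc (x - 2*h) (x + 2*h),
      |iteratedDerivWithin 5 y (Set.Icc (x - 2*h) (x + 2*h)) s| ≤ M) :
    |(y (x + 2*h) - 2 * y (x + h) + 2 * y (x - h) - y (x - 2*h)) / (2 * h^3)
        - iteratedDerivWithin 3 y (Set.Icc (x - 2*h) (x + 2*h)) x|
      ≤ 17 / 60 * h^2 * M := by
  have hs : UniqueDiffOn ℝ (Set.Icc (x - 2*h) (x + 2*h)) := uniqueDiffOn_Icc (by linarith)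
  have remainder : ∀ c : ℝ, c ≠ 0 → |c| ≤ 2 →
      |y (x + c * h) - taylorWithinEval y 4 (Set.Icc (x - 2*h) (x + 2*h)) x (x + c * h)|
        ≤ M * (|c| * h) ^ 5 / 120 := by
    intro c hc hc2
    obtain ⟨hl, hr⟩ := abs_le.mp hc2
    have hsub : Set.uIcc x (x + c * h) ⊆ Set.Icc (x - 2*h) (x + 2*h) :=
      Set.uIcc_subset_Icc ⟨by linarith, by linarith⟩ ⟨by nlinarith, by nlinarith⟩
    have hne : x ≠ x + c * h := by simp [hc, hh.ne']
    simpa [abs_mul, abs_of_pos hh, Nat.factorial] using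
      abs_sub_taylorWithinEval_le (n := 4) hs hy hne hsub hM
  have h2 := remainder 2 (by norm_num) (by norm_num)
  have h1 := remainder 1 (by norm_num) (by norm_num)
  have h1' := remainder (-1) (by norm_num) (by norm_num)
  have h2' := remainder (-2) (by norm_num) (by norm_num)
  rw [show x + 1 * h = x + h by ring] at h1
  rw [show x + -1 * h = x - h by ring] at h1'
  rw [show x + -2 * h = x - 2 * h by ring] at h2'
  simp only [taylor_within_apply, Finset.sum_range_succ, Finset.sum_range_zero, smul_eq_mul,
    Nat.factorial, abs_neg, abs_one, Nat.abs_ofNat] at h1 h2 h1' h2'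
  have hpos : 0 < 2 * h ^ 3 := by positivity
  rw [div_sub' hpos.ne', abs_div, abs_of_pos hpos, div_le_iff₀ hpos]
  rw [abs_le] at h1 h2 h1' h2' ⊢
  ring_nf at h1 h2 h1' h2' ⊢
  constructor <;> linarith
end

section
/- Let λ > 0 be real and let y : [0,1] → ℝ be twice continuously differentiable with y''(x) = −λ·(1 + y(x)²) for all x ∈ [0,1] and y(0) = y(1) = 0. Then y is symmetric about x = 1/2, i.e., y(x) = y(1−x) for all x ∈ [0,1]. -/
open Set in
/-- A function `y` on `[0,1]` with derivative `w` and second derivative `-lam * (1 + y ^ 2)` is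
symmetric about `1 / 2` as soon as its boundary values agree and its boundary slopes are
opposite. -/
theorem eq_reflection_of_boundary_slopes {lam : ℝ} {y w : ℝ → ℝ}
    (hy : ∀ x ∈ Icc (0:ℝ) 1, HasDerivWithinAt y (w x) (Icc 0 1) x)
    (hw : ∀ x ∈ Icc (0:ℝ) 1, HasDerivWithinAt w (-lam * (1 + (y x)^2)) (Icc 0 1) x)
    (hval : y 0 = y 1) (hslope : w 1 = -w 0) :
    ∀ x ∈ Icc (0:ℝ) 1, y x = y (1 - x) := by
  have hmaps : MapsTo (fun x : ℝ => 1 - x) (Icc 0 1) (Icc 0 1) := fun x hx =>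
    ⟨by linarith [hx.2], by linarith [hx.1]⟩
  have href : ∀ x : ℝ, HasDerivWithinAt (fun x : ℝ => 1 - x) (-1) (Icc 0 1) x := fun x =>
    ((hasDerivAt_id x).const_sub 1).hasDerivWithinAt
  have hcont : ContinuousOn y (Icc 0 1) := fun x hx => (hy x hx).continuousWithinAt
  obtain ⟨M, hM⟩ := isCompact_Icc.exists_bound_of_continuousOn hcont
  have hM0 : 0 ≤ M := (norm_nonneg _).trans (hM 0 (by simp))
  have hder : ∀ x ∈ Icc (0:ℝ) 1, HasDerivWithinAt
      (fun x => (y x - y (1 - x), w x + w (1 - x)))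
      (w x + w (1 - x), -lam * (y x + y (1 - x)) * (y x - y (1 - x))) (Icc 0 1) x := by
    intro x hx
    have h1 := (hy x hx).sub ((hy _ (hmaps hx)).comp x (href x) hmaps)
    have h2 := (hw x hx).add ((hw _ (hmaps hx)).comp x (href x) hmaps)
    refine (h1.prodMk h2).congr_deriv (Prod.ext ?_ ?_)
    · dsimp only
      ring
    · dsimp only
      ring
  intro x hx
  have hzero := eq_zero_of_abs_deriv_le_mul_abs_self_of_eq_zero_right
    (f := fun x => (y x - y (1 - x), w x + w (1 - x)))
    (f' := fun x => (w x + w (1 - x), -lam * (y x + y (1 - x)) * (y x - y (1 - x))))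
    (K := 1 + |lam| * (M + M)) (a := 0) (b := 1)
    (fun x hx => (hder x hx).continuousWithinAt)
    (fun x hx => (hder x ⟨hx.1, hx.2.le⟩).mono_of_mem_nhdsWithin
      (Icc_mem_nhdsGE_of_mem hx))
    (by simp [hval, hslope])
    (by
      intro x hx
      have hx' : x ∈ Icc (0:ℝ) 1 := ⟨hx.1, hx.2.le⟩
      set p : ℝ × ℝ := (y x - y (1 - x), w x + w (1 - x))
      have hK : 0 ≤ |lam| * (M + M) := by positivity
      refine norm_prod_le_iff.2 ⟨?_, ?_⟩
      · calc ‖p.2‖ ≤ 1 * ‖p‖ := by simpa using norm_snd_le p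
          _ ≤ _ := by gcongr; linarith
      · have hsum : ‖y x + y (1 - x)‖ ≤ M + M := norm_add_le_of_le (hM x hx') (hM _ (hmaps hx'))
        calc ‖-lam * (y x + y (1 - x)) * p.1‖ = |lam| * ‖y x + y (1 - x)‖ * ‖p.1‖ := by
              rw [norm_mul, norm_mul, norm_neg, Real.norm_eq_abs lam]
          _ ≤ |lam| * (M + M) * ‖p‖ := by gcongr; exact norm_fst_le p
          _ ≤ _ := by gcongr; linarith)
    x hx
  exact sub_eq_zero.1 (congrArg Prod.fst hzero)

open Set in
/-- The energy `w ^ 2 / 2 + lam * (y + y ^ 3 / 3)` is conserved along solutions of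
`y' = w`, `w' = -lam * (1 + y ^ 2)`. -/
theorem energy_endpoints_eq {lam : ℝ} {y w : ℝ → ℝ}
    (hy : ∀ x ∈ Icc (0:ℝ) 1, HasDerivWithinAt y (w x) (Icc 0 1) x)
    (hw : ∀ x ∈ Icc (0:ℝ) 1, HasDerivWithinAt w (-lam * (1 + (y x)^2)) (Icc 0 1) x) :
    w 1 ^ 2 / 2 + lam * (y 1 + y 1 ^ 3 / 3) = w 0 ^ 2 / 2 + lam * (y 0 + y 0 ^ 3 / 3) := by
  have hder : ∀ x ∈ Icc (0:ℝ) 1, HasDerivWithinAt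
      (fun x => w x ^ 2 / 2 + lam * (y x + y x ^ 3 / 3)) 0 (Icc 0 1) x := by
    intro x hx
    refine ((((hw x hx).pow 2).div_const 2).add
      (((hy x hx).add (((hy x hx).pow 3).div_const 3)).const_mul lam)).congr_deriv ?_
    push_cast
    ring
  exact constant_of_has_deriv_right_zero (fun x hx => (hder x hx).continuousWithinAt)
    (fun x hx => (hder x ⟨hx.1, hx.2.le⟩).mono_of_mem_nhdsWithin (Icc_mem_nhdsGE_of_mem hx))
    1 (by simp)

/-- Any twice continuously differentiable solution of `y'' = -λ (1 + y^2)` on `[0,1]`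
with zero boundary conditions (`λ > 0`) is symmetric about `x = 1/2`. -/
theorem solution_symmetric (lam : ℝ) (hlam : 0 < lam) (y : ℝ → ℝ)
    (hy : ContDiffOn ℝ 2 y (Set.Icc 0 1))
    (hode : ∀ x ∈ Set.Icc (0:ℝ) 1,
      iteratedDerivWithin 2 y (Set.Icc 0 1) x = -lam * (1 + (y x)^2))
    (h0 : y 0 = 0) (h1 : y 1 = 0) :
    ∀ x ∈ Set.Icc (0:ℝ) 1, y x = y (1 - x) := by
  set w := derivWithin y (Set.Icc 0 1)
  have hu : UniqueDiffOn ℝ (Set.Icc (0:ℝ) 1) := uniqueDiffOn_Icc one_pos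
  have hyw : ∀ x ∈ Set.Icc (0:ℝ) 1, HasDerivWithinAt y (w x) (Set.Icc 0 1) x := fun x hx =>
    (hy.differentiableOn (by norm_num) x hx).hasDerivWithinAt
  have hww : ∀ x ∈ Set.Icc (0:ℝ) 1,
      HasDerivWithinAt w (-lam * (1 + (y x)^2)) (Set.Icc 0 1) x := by
    intro x hx
    have hdiff : DifferentiableOn ℝ w (Set.Icc 0 1) :=
      (hy.derivWithin hu (m := 1) (by norm_num)).differentiableOn (by norm_num)
    rw [← hode x hx, iteratedDerivWithin_succ, iteratedDerivWithin_one]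
    exact (hdiff x hx).hasDerivWithinAt
  have hlt : w 1 < w 0 :=
    strictAntiOn_of_hasDerivWithinAt_neg (convex_Icc 0 1)
      (fun x hx => (hww x hx).continuousWithinAt)
      (fun x hx => (hww x (interior_subset hx)).mono interior_subset)
      (fun x _ => by
        have : 0 < lam * (1 + (y x)^2) := by positivity
        linarith) (by simp) (by simp) one_pos
  have hsq : w 1 ^ 2 = w 0 ^ 2 := by
    have := energy_endpoints_eq hyw hww
    rw [h0, h1] at this
    linarith
  exact eq_reflection_of_boundary_slopes hyw hww (h0.trans h1.symm)
    ((sq_eq_sq_iff_eq_or_eq_neg.1 hsq).resolve_left hlt.ne)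
end

section
/- Let λ > 0 be real and let y : [0,1] → ℝ be twice continuously differentiable with y''(x) = −λ·(1 + y(x)²) for all x ∈ [0,1] and y(0) = y(1) = 0. Then y(x) > 0 for all x ∈ (0,1). -/
/-- Any twice continuously differentiable solution of `y'' = -λ (1 + y^2)` on `[0,1]`
with zero boundary conditions (`λ > 0`) is strictly positive on `(0,1)`. -/
theorem solution_positive (lam : ℝ) (hlam : 0 < lam) (y : ℝ → ℝ)
    (hy : ContDiffOn ℝ 2 y (Set.Icc 0 1))
    (hode : ∀ x ∈ Set.Icc (0:ℝ) 1,
      iteratedDerivWithin 2 y (Set.Icc 0 1) x = -lam * (1 + (y x)^2))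
    (h0 : y 0 = 0) (h1 : y 1 = 0) :
    ∀ x ∈ Set.Ioo (0:ℝ) 1, 0 < y x := by
  have hconc : StrictConcaveOn ℝ (Set.Icc (0:ℝ) 1) y := by
    refine strictConcaveOn_of_deriv2_neg (convex_Icc 0 1) hy.continuousOn fun x hx => ?_
    have hnhds := mem_interior_iff_mem_nhds.1 hx
    have hx' := interior_subset hx
    rw [← iteratedDeriv_eq_iterate, ← iteratedDerivWithin_eq_iteratedDeriv
      (uniqueDiffOn_Icc zero_lt_one) (hy.contDiffAt hnhds) hx', hode x hx']
    exact mul_neg_of_neg_of_pos (neg_lt_zero.2 hlam) (by positivity)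
  intro x hx
  have hlt := hconc.2 (Set.left_mem_Icc.2 zero_le_one) (Set.right_mem_Icc.2 zero_le_one)
    zero_ne_one (sub_pos.2 hx.2) hx.1 (sub_add_cancel 1 x)
  simpa [h0, h1] using hlt
end
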